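/- Let g be a nontrivial two-mode real optical gate, i.e. a real 2×2 orthogonal matrix all of whose entries are nonzero, and let m ≥ 3. Then the topological closure of the subgroup of the orthogonal group O(m) generated by all the matrices g_{ij} (for 1 ≤ i < j ≤ m) contains every m×m special orthogonal matrix. -/

import Mathlib

/-- The m×m matrix obtained by applying the real 2×2 gate `g` to coordinates `i` and `j`
(with `i < j`) and the identity on all other coordinates. -/
def realGateOn {m : ℕ} (g : Matrix (Fin 2) (Fin 2) ℝ) (i j : Fin m) :
    Matrix (Fin m) (Fin m) ℝ :=
  Matrix.of fun k l =>
    if k = i ∧ l = i then g 0 0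
    else if k = i ∧ l = j then g 0 1
    else if k = j ∧ l = i then g 1 0
    else if k = j ∧ l = j then g 1 1
    else if k = l then 1 else 0


section OrthogonalGates

open Matrix

/-- Kronecker's theorem for a real number `a` in a number field of complex numbers. -/
theorem eq_zero_or_sq_eq_one_of_conjugates_norm_le_one (K : IntermediateField ℚ ℂ) [NumberField K]
    (x : K) (a : ℝ) (hxa : (x : ℂ) = a) (hintegral : IsIntegral ℤ x)
    (hle : ∀ φ : K →+* ℂ, ‖φ x‖ ≤ 1) : a = 0 ∨ a ^ 2 = 1 := by
  by_cases hx : x = 0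
  · left
    rw [hx, ZeroMemClass.coe_zero] at hxa
    exact_mod_cast hxa.symm
  · right
    obtain ⟨n, hn, h⟩ := NumberField.Embeddings.pow_eq_one_of_norm_le_one K ℂ hx hintegral hle
    have h1 : (a : ℂ) ^ n = 1 := by
      rw [← hxa]
      exact_mod_cast congrArg (fun y : K => (y : ℂ)) h
    have h2 : a ^ n = 1 := by exact_mod_cast h1
    have h3 : |a| = 1 := by
      have : |a| ^ n = 1 := by rw [← abs_pow, h2, abs_one]
      exact (pow_eq_one_iff_of_nonneg (abs_nonneg a) hn.ne').mp this
    rw [← sq_abs, h3, one_pow]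

theorem exists_real_eq_add_inv_of_pow_eq_one (z : ℂ) (n : ℕ) (hn : 0 < n) (hz : z ^ n = 1) :
    ∃ r : ℝ, z + z⁻¹ = r ∧ |r| ≤ 2 := by
  have h1 : ‖z‖ = 1 := Complex.norm_eq_one_of_pow_eq_one hz hn.ne'
  refine ⟨2 * z.re, ?_, ?_⟩
  · rw [Complex.inv_eq_conj h1, Complex.add_conj]
  · rw [abs_mul, abs_two]
    have := Complex.abs_re_le_norm z
    linarith

theorem isIntegral_add_inv_of_pow_eq_one {F : Type*} [Field F] (z : F) (n : ℕ) (hn : 0 < n)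
    (hz : z ^ n = 1) : IsIntegral ℤ (z + z⁻¹) := by
  refine IsIntegral.add ?_ ?_
  · exact IsIntegral.of_pow hn (hz ▸ isIntegral_one)
  · refine IsIntegral.of_pow hn ?_
    rw [inv_pow, hz, inv_one]
    exact isIntegral_one

/-- A real number which is one plus a sum of a root of unity and its inverse: the trace of a
three-dimensional rotation of finite order. -/
def IsTorsionTrace (t : ℝ) : Prop :=
  ∃ (z : ℂ) (n : ℕ), 0 < n ∧ z ^ n = 1 ∧ (t : ℂ) = 1 + (z + z⁻¹)

/-- Common number field for finitely many torsion traces and an algebraic number `a`. -/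
theorem exists_numberField_of_isTorsionTrace (a s t : ℝ) (ha : IsIntegral ℚ (a : ℂ))
    (hs : IsTorsionTrace s) (ht : IsTorsionTrace t) :
    ∃ (K : IntermediateField ℚ ℂ) (_ : NumberField K) (x u v : K), (x : ℂ) = a ∧ (u : ℂ) = s ∧
      (v : ℂ) = t ∧ IsIntegral ℤ u ∧ IsIntegral ℤ v ∧
      ∀ φ : K →+* ℂ, (∃ r : ℝ, φ u = r ∧ |r - 1| ≤ 2) ∧ (∃ r : ℝ, φ v = r ∧ |r - 1| ≤ 2) := by
  obtain ⟨z, n, hn, hz, hs⟩ := hs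
  obtain ⟨w, k, hk, hw, ht⟩ := ht
  let S : Set ℂ := {(a : ℂ), z, w}
  have hfin : FiniteDimensional ℚ (IntermediateField.adjoin ℚ S) := by
    have : Finite S := Set.toFinite _
    refine IntermediateField.finiteDimensional_adjoin ?_
    rintro x (rfl | rfl | rfl)
    · exact ha
    · exact IsIntegral.of_pow hn (hz ▸ isIntegral_one)
    · exact IsIntegral.of_pow hk (hw ▸ isIntegral_one)
  have hmem : ∀ x ∈ S, x ∈ IntermediateField.adjoin ℚ S := fun x hx =>
    IntermediateField.subset_adjoin ℚ S hx
  let K := IntermediateField.adjoin ℚ S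
  let z' : K := ⟨z, hmem z (by simp [S])⟩
  let w' : K := ⟨w, hmem w (by simp [S])⟩
  have hz' : z' ^ n = 1 := Subtype.ext hz
  have hw' : w' ^ k = 1 := Subtype.ext hw
  have key : ∀ (y : K) (l : ℕ), 0 < l → y ^ l = 1 → ∀ φ : K →+* ℂ,
      ∃ r : ℝ, φ (1 + (y + y⁻¹)) = r ∧ |r - 1| ≤ 2 := by
    intro y l hl hy φ
    obtain ⟨r, hr, hr2⟩ := exists_real_eq_add_inv_of_pow_eq_one (φ y) l hl
      (by rw [← map_pow, hy, map_one])
    refine ⟨1 + r, ?_, by simpa using hr2⟩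
    rw [map_add, map_one, map_add, map_inv₀, hr]
    push_cast
    rfl
  refine ⟨K, { to_charZero := inferInstance, to_finiteDimensional := hfin },
    ⟨a, hmem _ (by simp [S])⟩, 1 + (z' + z'⁻¹), 1 + (w' + w'⁻¹), rfl, hs.symm, ht.symm,
    isIntegral_one.add (isIntegral_add_inv_of_pow_eq_one z' n hn hz'),
    isIntegral_one.add (isIntegral_add_inv_of_pow_eq_one w' k hk hw'),
    fun φ => ⟨key z' n hn hz' φ, key w' k hk hw' φ⟩⟩

theorem IsTorsionTrace.isIntegral {t : ℝ} (ht : IsTorsionTrace t) : IsIntegral ℤ (t : ℂ) := by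
  obtain ⟨z, n, hn, hz, hs⟩ := ht
  rw [hs]
  exact isIntegral_one.add (isIntegral_add_inv_of_pow_eq_one z n hn hz)

theorem eq_zero_or_sq_eq_one_of_rotation_traces (a : ℝ) (h₁ : IsTorsionTrace (1 + 2 * a))
    (h₂ : IsTorsionTrace (a ^ 2 + 2 * a)) : a = 0 ∨ a ^ 2 = 1 := by
  have hsq : IsIntegral ℤ ((a : ℂ) ^ 2) := by
    have e : (a : ℂ) ^ 2 = ((a ^ 2 + 2 * a : ℝ) : ℂ) - ((1 + 2 * a : ℝ) : ℂ) + 1 := by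
      push_cast
      ring
    rw [e]
    exact (h₂.isIntegral.sub h₁.isIntegral).add isIntegral_one
  have ha : IsIntegral ℤ (a : ℂ) := IsIntegral.of_pow two_pos hsq
  obtain ⟨K, _, x, u, v, hx, hu, hv, hui, hvi, hφ⟩ :=
    exists_numberField_of_isTorsionTrace a _ _ (ha.tower_top) h₁ h₂
  have hux : u = 1 + 2 * x := by
    apply Subtype.ext
    push_cast
    rw [hu, hx]
    push_cast
    rfl
  refine eq_zero_or_sq_eq_one_of_conjugates_norm_le_one K x a hx ?_ ?_
  · refine (isIntegral_algebraMap_iff (B := ℂ) (algebraMap K ℂ).injective).mp ?_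
    change IsIntegral ℤ (x : ℂ)
    rw [hx]
    exact ha
  · intro φ
    obtain ⟨⟨r, hr, hr2⟩, -⟩ := hφ φ
    have h3 : φ x = (((r - 1) / 2 : ℝ) : ℂ) := by
      rw [hux, map_add, map_mul, map_one, map_ofNat] at hr
      push_cast
      rw [← hr]
      ring
    rw [h3, Complex.norm_real, Real.norm_eq_abs, abs_div, abs_two]
    linarith

theorem eq_zero_or_sq_eq_one_of_reflection_traces (a : ℝ) (h₁ : IsTorsionTrace (a ^ 2 - 2 * a))
    (h₂ : IsTorsionTrace (-a ^ 2)) : a = 0 ∨ a ^ 2 = 1 := by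
  have hsq : IsIntegral ℤ ((a : ℂ) ^ 2) := by
    convert h₂.isIntegral.neg using 1
    push_cast
    ring
  have ha : IsIntegral ℤ (a : ℂ) := IsIntegral.of_pow two_pos hsq
  obtain ⟨K, _, x, u, v, hx, hu, hv, hui, hvi, hφ⟩ :=
    exists_numberField_of_isTorsionTrace a _ _ (ha.tower_top) h₁ h₂
  have hux : u = x ^ 2 - 2 * x := by
    apply Subtype.ext
    push_cast
    rw [hu, hx]
    push_cast
    rfl
  have hvx : v = - x ^ 2 := by
    apply Subtype.ext
    push_cast
    rw [hv, hx]
    push_cast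
    rfl
  refine eq_zero_or_sq_eq_one_of_conjugates_norm_le_one K x a hx ?_ ?_
  · refine (isIntegral_algebraMap_iff (B := ℂ) (algebraMap K ℂ).injective).mp ?_
    change IsIntegral ℤ (x : ℂ)
    rw [hx]
    exact ha
  · intro φ
    obtain ⟨⟨r, hr, hr2⟩, ⟨q, hq, hq2⟩⟩ := hφ φ
    rw [hux, map_sub, map_mul, map_pow, map_ofNat] at hr
    rw [hvx, map_neg, map_pow] at hq
    have h3 : φ x = ((-(r + q) / 2 : ℝ) : ℂ) := by
      push_cast
      rw [← hr, ← hq]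
      ring
    have h4 : (-(r + q) / 2) ^ 2 = - q := by
      have : ((((-(r + q) / 2) ^ 2 : ℝ)) : ℂ) = ((- q : ℝ) : ℂ) := by
        rw [Complex.ofReal_pow, ← h3, Complex.ofReal_neg, ← hq, neg_neg]
      exact_mod_cast this
    rw [h3, Complex.norm_real, Real.norm_eq_abs, ← sq_le_one_iff_abs_le_one, h4]
    have := (abs_le.mp hq2).1
    linarith

section Rodrigues

variable {n : Type*} [Fintype n] [DecidableEq n]

/-- The exponential `exp (t • K)` of a matrix with `K ^ 3 = -K`, by Rodrigues' formula. -/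
noncomputable def rodrigues (K : Matrix n n ℝ) (t : ℝ) : Matrix n n ℝ :=
  1 + Real.sin t • K + (1 - Real.cos t) • (K * K)

theorem rodrigues_zero (K : Matrix n n ℝ) : rodrigues K 0 = 1 := by
  simp [rodrigues]

theorem rodrigues_add {K : Matrix n n ℝ} (hK : K * K * K = -K) (s t : ℝ) :
    rodrigues K (s + t) = rodrigues K s * rodrigues K t := by
  have h4 : K * K * (K * K) = -(K * K) := by rw [← mul_assoc, hK, neg_mul]
  have h3 : K * (K * K) = -K := by rw [← mul_assoc, hK]
  simp only [rodrigues, Real.sin_add, Real.cos_add, mul_add, add_mul, one_mul, mul_one,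
    smul_mul_assoc, mul_smul_comm, hK, h3, h4]
  module

theorem rodrigues_transpose {K : Matrix n n ℝ} (hs : Kᵀ = -K) (t : ℝ) :
    (rodrigues K t)ᵀ = rodrigues K (-t) := by
  simp [rodrigues, hs, transpose_mul]

theorem rodrigues_neg (K : Matrix n n ℝ) (t : ℝ) : rodrigues (-K) t = rodrigues K (-t) := by
  simp [rodrigues]

/-- Rodrigues' formula as a one-parameter subgroup of the orthogonal group. -/
noncomputable def rodriguesOrtho (K : Matrix n n ℝ) (hs : Kᵀ = -K) (hK : K * K * K = -K) (t : ℝ) :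
    orthogonalGroup n ℝ :=
  ⟨rodrigues K t, by
    rw [mem_orthogonalGroup_iff, rodrigues_transpose hs, ← rodrigues_add hK, add_neg_cancel,
      rodrigues_zero]⟩

theorem continuous_rodriguesOrtho (K : Matrix n n ℝ) (hs : Kᵀ = -K) (hK : K * K * K = -K) :
    Continuous (rodriguesOrtho K hs hK) := by
  refine Continuous.subtype_mk ?_ _
  unfold rodrigues
  fun_prop

theorem rodriguesOrtho_add (K : Matrix n n ℝ) (hs : Kᵀ = -K) (hK : K * K * K = -K) (s t : ℝ) :
    rodriguesOrtho K hs hK (s + t) = rodriguesOrtho K hs hK s * rodriguesOrtho K hs hK t :=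
  Subtype.ext (rodrigues_add hK s t)

theorem rodriguesOrtho_zero (K : Matrix n n ℝ) (hs : Kᵀ = -K) (hK : K * K * K = -K) :
    rodriguesOrtho K hs hK 0 = 1 :=
  Subtype.ext (rodrigues_zero K)

theorem rodriguesOrtho_two_pi (K : Matrix n n ℝ) (hs : Kᵀ = -K) (hK : K * K * K = -K) :
    rodriguesOrtho K hs hK (2 * Real.pi) = 1 :=
  Subtype.ext (by simp [rodriguesOrtho, rodrigues])

/-- A closed subgroup containing an irrational rotation contains all rotations about its axis. -/
theorem rodriguesOrtho_mem_of_irrational (K : Matrix n n ℝ) (hs : Kᵀ = -K) (hK : K * K * K = -K)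
    (H : Subgroup (orthogonalGroup n ℝ)) (hH : IsClosed (H : Set (orthogonalGroup n ℝ)))
    (θ : ℝ) (hθ : Irrational (θ / (2 * Real.pi))) (hmem : rodriguesOrtho K hs hK θ ∈ H) (t : ℝ) :
    rodriguesOrtho K hs hK t ∈ H := by
  let e : Multiplicative ℝ →* orthogonalGroup n ℝ :=
    { toFun := fun t => rodriguesOrtho K hs hK t.toAdd
      map_one' := rodriguesOrtho_zero K hs hK
      map_mul' := fun s t => rodriguesOrtho_add K hs hK s.toAdd t.toAdd }
  let T : AddSubgroup ℝ := Subgroup.toAddSubgroup' (H.comap e)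
  have hT : IsClosed (T : Set ℝ) := hH.preimage (continuous_rodriguesOrtho K hs hK)
  have hsub : AddSubgroup.closure {θ, 2 * Real.pi} ≤ T := by
    rw [AddSubgroup.closure_le]
    rintro x (rfl | rfl)
    · exact hmem
    · change rodriguesOrtho K hs hK (2 * Real.pi) ∈ H
      rw [rodriguesOrtho_two_pi]
      exact H.one_mem
  have hd : Dense (T : Set ℝ) := (dense_addSubgroupClosure_pair_iff.mpr hθ).mono hsub
  have : t ∈ (T : Set ℝ) := by
    rw [← hT.closure_eq, hd.closure_eq]
    trivial
  exact this

end Rodrigues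

/-- The real skew-symmetric 3×3 matrix with the given entries above the diagonal. -/
def skewThree (x y z : ℝ) : Matrix (Fin 3) (Fin 3) ℝ :=
  !![0, x, y; -x, 0, z; -y, -z, 0]

theorem skewThree_transpose (x y z : ℝ) : (skewThree x y z)ᵀ = -skewThree x y z := by
  ext i j
  fin_cases i <;> fin_cases j <;> simp [skewThree]

theorem exists_eq_skewThree {W : Matrix (Fin 3) (Fin 3) ℝ} (hW : Wᵀ = -W) :
    W = skewThree (W 0 1) (W 0 2) (W 1 2) := by
  have h : ∀ i j, W j i = -W i j := fun i j => congrFun (congrFun hW i) j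
  have h0 := h 0 0
  have h1 := h 1 1
  have h2 := h 2 2
  ext i j
  fin_cases i <;> fin_cases j <;> simp [skewThree] <;> first | linarith | exact h _ _

theorem skewThree_cube (x y z : ℝ) :
    skewThree x y z * skewThree x y z * skewThree x y z
      = -((x ^ 2 + y ^ 2 + z ^ 2) • skewThree x y z) := by
  ext i j
  fin_cases i <;> fin_cases j <;> simp [skewThree, mul_apply, Fin.sum_univ_three] <;> ring

theorem skewThree_cube_of_unit {x y z : ℝ} (h : x ^ 2 + y ^ 2 + z ^ 2 = 1) :
    skewThree x y z * skewThree x y z * skewThree x y z = -skewThree x y z := by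
  rw [skewThree_cube, h, one_smul]

theorem trace_skewThree_sq (x y z : ℝ) :
    (skewThree x y z * skewThree x y z).trace = -2 * (x ^ 2 + y ^ 2 + z ^ 2) := by
  simp [skewThree, trace, Fin.sum_univ_three]
  ring

theorem adjugate_three_eq (R : Matrix (Fin 3) (Fin 3) ℝ) :
    R.adjugate = R * R - R.trace • R + R.adjugate.trace • (1 : Matrix (Fin 3) (Fin 3) ℝ) := by
  rw [eta_fin_three R, adjugate_fin_three_of]
  ext i j
  fin_cases i <;> fin_cases j <;>
    simp [trace, Fin.sum_univ_three] <;> ring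

theorem skew_part_sq_of_rotation {R : Matrix (Fin 3) (Fin 3) ℝ} (hR : R * Rᵀ = 1)
    (hdet : R.det = 1) :
    (R - Rᵀ) * (R - Rᵀ) = (R.trace + 1) • (R + Rᵀ) - (2 * (R.trace + 1)) • 1 := by
  have hR' : Rᵀ * R = 1 := mul_eq_one_comm.mp hR
  have hadj : R.adjugate = Rᵀ := by
    have h := adjugate_mul R
    rw [hdet, one_smul] at h
    calc R.adjugate = R.adjugate * (R * Rᵀ) := by rw [hR, mul_one]
      _ = Rᵀ := by rw [← mul_assoc, h, one_mul]
  have h1 : Rᵀ = R * R - R.trace • R + R.trace • (1 : Matrix (Fin 3) (Fin 3) ℝ) := by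
    have := adjugate_three_eq R
    rwa [hadj, trace_transpose] at this
  have h2 : R * R = Rᵀ + R.trace • R - R.trace • 1 := by
    rw [h1]
    abel
  have h3 : Rᵀ * Rᵀ = R + R.trace • Rᵀ - R.trace • 1 := by
    have := congrArg transpose h2
    simpa [transpose_mul] using this
  rw [sub_mul, mul_sub, mul_sub, h2, h3, hR, hR']
  module

/-- A rotation of three-space either rotates by an irrational angle, or its trace is that of
an element of finite order. -/
theorem rotation_irrational_or_isTorsionTrace {R : Matrix (Fin 3) (Fin 3) ℝ} (hR : R * Rᵀ = 1)
    (hdet : R.det = 1) :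
    (∃ x y z θ : ℝ, x ^ 2 + y ^ 2 + z ^ 2 = 1 ∧ Irrational (θ / (2 * Real.pi)) ∧
      R = rodrigues (skewThree x y z) θ) ∨ IsTorsionTrace R.trace := by
  have hsq := skew_part_sq_of_rotation hR hdet
  set t := R.trace with ht
  have hskew : (R - Rᵀ)ᵀ = -(R - Rᵀ) := by simp
  have hA := exists_eq_skewThree hskew
  set p := (R - Rᵀ) 0 1
  set q := (R - Rᵀ) 0 2
  set w := (R - Rᵀ) 1 2
  have htr : -2 * (p ^ 2 + q ^ 2 + w ^ 2) = (t + 1) * (2 * t) - 2 * (t + 1) * 3 := by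
    rw [← trace_skewThree_sq, ← hA, hsq]
    simp [trace_add, trace_sub, trace_smul, trace_transpose, ← ht]
    ring
  have hnn : 0 ≤ p ^ 2 + q ^ 2 + w ^ 2 := by positivity
  rcases hnn.eq_or_lt with h0 | hpos
  · right
    have hfac : (t + 1) * (t - 3) = 0 := by nlinarith
    rcases mul_eq_zero.mp hfac with h | h
    · refine ⟨-1, 2, two_pos, by norm_num, ?_⟩
      rw [show t = -1 by linarith]
      norm_num
    · refine ⟨1, 1, one_pos, by norm_num, ?_⟩
      rw [show t = 3 by linarith]
      norm_num
  · set σ := Real.sqrt (p ^ 2 + q ^ 2 + w ^ 2) with hσ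
    have hσpos : 0 < σ := Real.sqrt_pos.mpr hpos
    have hσsq : σ ^ 2 = p ^ 2 + q ^ 2 + w ^ 2 := Real.sq_sqrt hnn
    have hrel : σ ^ 2 = (t + 1) * (3 - t) := by rw [hσsq]; linarith
    have hprod : 0 < (t + 1) * (3 - t) := hrel ▸ pow_pos hσpos 2
    have ht1 : -1 < t := by nlinarith
    have ht2 : t < 3 := by nlinarith
    set θ := Real.arccos ((t - 1) / 2) with hθ
    have hcos : Real.cos θ = (t - 1) / 2 :=
      Real.cos_arccos (by linarith) (by linarith)
    have hsin : Real.sin θ = σ / 2 := by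
      rw [hθ, Real.sin_arccos, show 1 - ((t - 1) / 2) ^ 2 = (σ / 2) ^ 2 by nlinarith,
        Real.sqrt_sq (by positivity)]
    by_cases hirr : Irrational (θ / (2 * Real.pi))
    · left
      refine ⟨p / σ, q / σ, w / σ, θ, ?_, hirr, ?_⟩
      · rw [div_pow, div_pow, div_pow, ← add_div, ← add_div, hσsq, div_self hpos.ne']
      · have hK : skewThree (p / σ) (q / σ) (w / σ) = σ⁻¹ • (R - Rᵀ) := by
          rw [hA]
          ext i j
          fin_cases i <;> fin_cases j <;> simp [skewThree] <;> ring
        rw [rodrigues, hK, hsin, hcos, smul_mul_smul_comm, smul_smul, smul_smul, hsq]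
        have e1 : σ / 2 * σ⁻¹ = 1 / 2 := by field_simp
        have e2 : (1 - (t - 1) / 2) * ((σ⁻¹ * σ⁻¹)) * (t + 1) = 1 / 2 := by
          field_simp
          linarith
        rw [e1, smul_sub (_ * _), smul_smul, smul_smul, e2,
          show (1 - (t - 1) / 2) * (σ⁻¹ * σ⁻¹) * (2 * (t + 1)) = 1 by linarith]
        module
    · right
      rw [irrational_iff_ne_rational] at hirr
      push Not at hirr
      obtain ⟨a, b, hb, hab⟩ := hirr
      have hangle : θ * b = a * (2 * Real.pi) := by
        have hbR : (b : ℝ) ≠ 0 := by exact_mod_cast hb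
        field_simp at hab
        linarith
      have hpow : Complex.exp (θ * Complex.I) ^ b = 1 := by
        rw [← Complex.exp_int_mul, Complex.exp_eq_one_iff]
        refine ⟨a, ?_⟩
        have : (θ : ℂ) * b = a * (2 * Real.pi) := by exact_mod_cast hangle
        linear_combination this * Complex.I
      refine ⟨Complex.exp (θ * Complex.I), b.natAbs, Int.natAbs_pos.mpr hb, ?_, ?_⟩
      · rcases Int.natAbs_eq b with h | h
        · rw [h, zpow_natCast] at hpow
          simpa using hpow
        · rw [h, _root_.zpow_neg, zpow_natCast, inv_eq_one] at hpow
          simpa using hpow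
      · have h2 : (t : ℂ) = 1 + 2 * Complex.cos θ := by
          rw [← Complex.ofReal_cos, hcos]
          push_cast
          ring
        rw [h2, Complex.two_cos, ← Complex.exp_neg, neg_mul]

theorem compactSpace_orthogonalGroup (n : Type*) [Fintype n] [DecidableEq n] :
    CompactSpace (orthogonalGroup n ℝ) := by
  refine isCompact_iff_compactSpace.mp ?_
  have hK : IsCompact (Set.univ.pi fun _ : n => Set.univ.pi fun _ : n => Set.Icc (-1 : ℝ) 1) :=
    isCompact_univ_pi fun _ => isCompact_univ_pi fun _ => isCompact_Icc
  refine hK.of_isClosed_subset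
    (isClosed_unitary : IsClosed (unitary (Matrix n n ℝ) : Set (Matrix n n ℝ))) ?_
  intro U hU i _ j _
  have := entry_norm_bound_of_unitary hU i j
  rw [Real.norm_eq_abs] at this
  exact abs_le.mp this

section Conjugation

variable {n : Type*} [Fintype n] [DecidableEq n]

theorem orthogonal_mul_transpose (h : orthogonalGroup n ℝ) :
    (h : Matrix n n ℝ) * (h : Matrix n n ℝ)ᵀ = 1 :=
  (mem_orthogonalGroup_iff n ℝ).mp h.2

theorem orthogonal_transpose_mul (h : orthogonalGroup n ℝ) :
    (h : Matrix n n ℝ)ᵀ * (h : Matrix n n ℝ) = 1 :=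
  (mem_orthogonalGroup_iff' n ℝ).mp h.2

theorem orthogonal_coe_inv (h : orthogonalGroup n ℝ) :
    ((h⁻¹ : orthogonalGroup n ℝ) : Matrix n n ℝ) = (h : Matrix n n ℝ)ᵀ :=
  rfl

omit [DecidableEq n] in
theorem conj_skew {K : Matrix n n ℝ} (hs : Kᵀ = -K) (h : Matrix n n ℝ) :
    (h * K * hᵀ)ᵀ = -(h * K * hᵀ) := by
  simp [transpose_mul, hs, mul_assoc]

theorem conj_cube {K : Matrix n n ℝ} (hK : K * K * K = -K) (h : orthogonalGroup n ℝ) :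
    ((h : Matrix n n ℝ) * K * (h : Matrix n n ℝ)ᵀ) * (h * K * (h : Matrix n n ℝ)ᵀ)
      * (h * K * (h : Matrix n n ℝ)ᵀ) = -(h * K * (h : Matrix n n ℝ)ᵀ) := by
  have e : ∀ A : Matrix n n ℝ, (h : Matrix n n ℝ)ᵀ * (h * A) = A := fun A => by
    rw [← mul_assoc, orthogonal_transpose_mul, one_mul]
  simp only [mul_assoc, e]
  rw [show K * (K * (K * (h : Matrix n n ℝ)ᵀ)) = K * K * K * (h : Matrix n n ℝ)ᵀ by
    simp only [mul_assoc], hK]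
  simp

theorem rodrigues_conj (K : Matrix n n ℝ) (h : orthogonalGroup n ℝ) (t : ℝ) :
    rodrigues ((h : Matrix n n ℝ) * K * (h : Matrix n n ℝ)ᵀ) t
      = h * rodrigues K t * (h : Matrix n n ℝ)ᵀ := by
  have e : ∀ A : Matrix n n ℝ, (h : Matrix n n ℝ)ᵀ * (h * A) = A := fun A => by
    rw [← mul_assoc, orthogonal_transpose_mul, one_mul]
  simp only [rodrigues, mul_add, add_mul, mul_one, orthogonal_mul_transpose, mul_smul_comm,
    smul_mul_assoc, mul_assoc, e]

/-- The first variation of a linear functional along a rotation conjugating `X`. -/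
theorem trace_commutator_eq_zero_of_max (X Y E : Matrix n n ℝ)
    (hmax : ∀ t, (rodrigues Y t * X * rodrigues Y (-t) * E).trace ≤ (X * E).trace) :
    ((Y * X - X * Y) * E).trace = 0 := by
  let α := ((Y * X - X * Y) * E).trace
  let β := ((Y * Y * X + X * (Y * Y)) * E).trace
  let γ := (Y * X * Y * E).trace
  let δ := ((Y * X * (Y * Y) - Y * Y * X * Y) * E).trace
  let ε := (Y * Y * X * (Y * Y) * E).trace
  let f : ℝ → ℝ := fun t => Real.sin t * α + (1 - Real.cos t) * β - Real.sin t ^ 2 * γ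
    + Real.sin t * (1 - Real.cos t) * δ + (1 - Real.cos t) ^ 2 * ε
  have hf : ∀ t, (rodrigues Y t * X * rodrigues Y (-t) * E).trace = (X * E).trace + f t := by
    intro t
    simp only [rodrigues, f, α, β, γ, δ, ε, Real.sin_neg, Real.cos_neg, mul_add, add_mul, sub_mul,
      one_mul, mul_one, smul_mul_assoc, mul_smul_comm, trace_add, trace_sub, trace_smul,
      smul_eq_mul, mul_assoc]
    ring
  have hloc : IsLocalMax f 0 := Filter.Eventually.of_forall fun t => by
    have h0 : f 0 = 0 := by simp [f]
    have := hmax t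
    rw [hf] at this
    rw [h0]
    linarith
  have hs := Real.hasDerivAt_sin 0
  have hc := (Real.hasDerivAt_cos 0).const_sub 1
  have hd := ((((hs.mul_const α).add (hc.mul_const β)).sub ((hs.pow 2).mul_const γ)).add
    ((hs.mul hc).mul_const δ)).add ((hc.pow 2).mul_const ε)
  have h := hloc.hasDerivAt_eq_zero hd
  simpa using h

end Conjugation

theorem eq_or_eq_neg_of_commute_skewThree {x y z p q r : ℝ} (h₁ : x ^ 2 + y ^ 2 + z ^ 2 = 1)
    (h₂ : p ^ 2 + q ^ 2 + r ^ 2 = 1)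
    (h : skewThree x y z * skewThree p q r = skewThree p q r * skewThree x y z) :
    skewThree p q r = skewThree x y z ∨ skewThree p q r = -skewThree x y z := by
  have a := congrFun (congrFun h 0) 1
  have b := congrFun (congrFun h 0) 2
  have c := congrFun (congrFun h 1) 2
  simp [skewThree, mul_apply, Fin.sum_univ_three] at a b c
  have hp : p = (x * p + y * q + z * r) * x := by grind
  have hq : q = (x * p + y * q + z * r) * y := by grind
  have hr : r = (x * p + y * q + z * r) * z := by grind
  have hsq : (x * p + y * q + z * r) ^ 2 = 1 := by grind
  rw [sq, mul_self_eq_one_iff] at hsq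
  rcases hsq with h | h
  · left
    rw [h, one_mul] at hp hq hr
    rw [hp, hq, hr]
  · right
    rw [h] at hp hq hr
    rw [hp, hq, hr]
    ext i j
    fin_cases i <;> fin_cases j <;> simp [skewThree]

/-- A closed subgroup of `O(3)` acting irreducibly on skew matrices which contains the
rotations about one axis contains the rotations about every axis. -/
theorem rodrigues_mem_of_irreducible (H : Subgroup (orthogonalGroup (Fin 3) ℝ))
    (hH : IsClosed (H : Set (orthogonalGroup (Fin 3) ℝ))) {x y z p q r : ℝ}
    (hu : x ^ 2 + y ^ 2 + z ^ 2 = 1) (hv : p ^ 2 + q ^ 2 + r ^ 2 = 1)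
    (hmem : ∀ t, ∃ h ∈ H, (h : Matrix (Fin 3) (Fin 3) ℝ) = rodrigues (skewThree x y z) t)
    (hirr : ∀ W : Matrix (Fin 3) (Fin 3) ℝ, Wᵀ = -W →
      (∀ h ∈ H, ((h : Matrix (Fin 3) (Fin 3) ℝ) * W * (h : Matrix (Fin 3) (Fin 3) ℝ)ᵀ
        * skewThree x y z).trace = 0) → W = 0) (t : ℝ) :
    ∃ h ∈ H, (h : Matrix (Fin 3) (Fin 3) ℝ) = rodrigues (skewThree p q r) t := by
  set K := skewThree x y z with hKdef
  set E := skewThree p q r with hEdef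
  have hKs : Kᵀ = -K := skewThree_transpose x y z
  have hEs : Eᵀ = -E := skewThree_transpose p q r
  have hK3 : K * K * K = -K := skewThree_cube_of_unit hu
  have := compactSpace_orthogonalGroup (Fin 3)
  let F : orthogonalGroup (Fin 3) ℝ → ℝ := fun h =>
    ((h : Matrix (Fin 3) (Fin 3) ℝ) * K * (h : Matrix (Fin 3) (Fin 3) ℝ)ᵀ * E).trace
  have hF : Continuous F := by
    have : Continuous fun h : orthogonalGroup (Fin 3) ℝ => (h : Matrix (Fin 3) (Fin 3) ℝ) :=
      continuous_subtype_val
    fun_prop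
  obtain ⟨h₀, hh₀, hmax⟩ := hH.isCompact.exists_isMaxOn ⟨1, H.one_mem⟩ hF.continuousOn
  set X := (h₀ : Matrix (Fin 3) (Fin 3) ℝ) * K * (h₀ : Matrix (Fin 3) (Fin 3) ℝ)ᵀ with hX
  have hXs : Xᵀ = -X := conj_skew hKs _
  have hX3 : X * X * X = -X := conj_cube hK3 h₀
  have hrot : ∀ h ∈ H, ∀ t, ∃ k ∈ H, (k : Matrix (Fin 3) (Fin 3) ℝ) =
      rodrigues ((h : Matrix (Fin 3) (Fin 3) ℝ) * K * (h : Matrix (Fin 3) (Fin 3) ℝ)ᵀ) t := by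
    intro h hh t
    obtain ⟨k, hk, hkt⟩ := hmem t
    refine ⟨h * k * h⁻¹, H.mul_mem (H.mul_mem hh hk) (H.inv_mem hh), ?_⟩
    rw [rodrigues_conj, ← hkt]
    rfl
  have hcomm : X * E - E * X = 0 := by
    refine hirr _ ?_ ?_
    · simp [transpose_mul, hXs, hEs]
    · intro h hh
      have hcrit := trace_commutator_eq_zero_of_max X
        ((h : Matrix (Fin 3) (Fin 3) ℝ)ᵀ * K * h) E (by
          intro t
          obtain ⟨k, hk, hkt⟩ := hrot h⁻¹ (H.inv_mem hh) t
          rw [orthogonal_coe_inv, transpose_transpose] at hkt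
          have hle : F (k * h₀) ≤ F h₀ := hmax (H.mul_mem hk hh₀)
          have hskew := conj_skew hKs (h : Matrix (Fin 3) (Fin 3) ℝ)ᵀ
          rw [transpose_transpose] at hskew
          rw [← rodrigues_transpose hskew, ← hkt]
          simpa only [F, hX, Subgroup.coe_mul, Submonoid.coe_mul, transpose_mul, mul_assoc]
            using hle)
      set Y := (h : Matrix (Fin 3) (Fin 3) ℝ)ᵀ * K * h with hY
      have e1 : ((h : Matrix (Fin 3) (Fin 3) ℝ) * (X * E - E * X)
          * (h : Matrix (Fin 3) (Fin 3) ℝ)ᵀ * K).trace = ((X * E - E * X) * Y).trace := by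
        rw [hY, mul_assoc, mul_assoc, trace_mul_comm]
        simp only [mul_assoc]
      rw [e1, sub_mul, trace_sub, mul_assoc E, trace_mul_comm E, trace_mul_comm (X * E),
        ← mul_assoc]
      rwa [sub_mul, trace_sub] at hcrit
  have hXE := exists_eq_skewThree hXs
  have hXunit : X 0 1 ^ 2 + X 0 2 ^ 2 + X 1 2 ^ 2 = 1 := by
    have h1 := trace_skewThree_sq (X 0 1) (X 0 2) (X 1 2)
    have h2 : (K * K).trace = -2 * (x ^ 2 + y ^ 2 + z ^ 2) := trace_skewThree_sq x y z
    rw [← hXE] at h1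
    have h3 : (X * X).trace = (K * K).trace := by
      have e : ∀ A : Matrix (Fin 3) (Fin 3) ℝ, (h₀ : Matrix (Fin 3) (Fin 3) ℝ)ᵀ * (h₀ * A) = A :=
        fun A => by rw [← mul_assoc, orthogonal_transpose_mul, one_mul]
      simp only [hX, mul_assoc, e]
      rw [trace_mul_comm]
      simp only [mul_assoc, orthogonal_transpose_mul, mul_one]
    linarith
  have hpm : E = X ∨ E = -X := by
    rw [hXE]
    refine eq_or_eq_neg_of_commute_skewThree hXunit hv ?_
    rw [← hXE]
    exact sub_eq_zero.mp hcomm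
  rcases hpm with h | h
  · rw [h]
    exact hrot h₀ hh₀ t
  · rw [h, rodrigues_neg]
    exact hrot h₀ hh₀ (-t)

theorem realGateOn_zero_one (g : Matrix (Fin 2) (Fin 2) ℝ) :
    realGateOn g (0 : Fin 3) 1 = !![g 0 0, g 0 1, 0; g 1 0, g 1 1, 0; 0, 0, 1] := by
  ext i j
  fin_cases i <;> fin_cases j <;> simp [realGateOn]

theorem realGateOn_zero_two (g : Matrix (Fin 2) (Fin 2) ℝ) :
    realGateOn g (0 : Fin 3) 2 = !![g 0 0, 0, g 0 1; 0, 1, 0; g 1 0, 0, g 1 1] := by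
  ext i j
  fin_cases i <;> fin_cases j <;> simp [realGateOn]

theorem realGateOn_one_two (g : Matrix (Fin 2) (Fin 2) ℝ) :
    realGateOn g (1 : Fin 3) 2 = !![1, 0, 0; 0, g 0 0, g 0 1; 0, g 1 0, g 1 1] := by
  ext i j
  fin_cases i <;> fin_cases j <;> simp [realGateOn]

/-- A subspace of the skew matrices (in coordinates) stable under the three coordinate rotations
is trivial. -/
theorem forall_of_invariant_rotation {a b : ℝ} (hab : a ^ 2 + b ^ 2 = 1) (hb : b ≠ 0)
    (P : ℝ → ℝ → ℝ → Prop)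
    (hlin : ∀ c d x y z x' y' z', P x y z → P x' y' z' →
      P (c * x + d * x') (c * y + d * y') (c * z + d * z'))
    (h₁ : ∀ x y z, P x y z → P x (a * y - b * z) (b * y + a * z))
    (h₂ : ∀ x y z, P x y z → P (a * x + b * z) y (a * z - b * x))
    (h₃ : ∀ x y z, P x y z → P (a * x - b * y) (b * x + a * y) z)
    {x y z : ℝ} (h : P x y z) (hne : ¬(x = 0 ∧ y = 0 ∧ z = 0)) (p q r : ℝ) : P p q r := by
  have ha : 2 - 2 * a ≠ 0 := fun h => hb (by
    have : a = 1 := by linarith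
    rw [this] at hab
    nlinarith)
  have hcomb : ∀ x y z, P 1 0 0 → P 0 1 0 → P 0 0 1 → P x y z := fun x y z e₁ e₂ e₃ => by
    simpa using hlin 1 z _ _ _ _ _ _ (hlin x y _ _ _ _ _ _ e₁ e₂) e₃
  have e12 : P 1 0 0 → P 0 1 0 := fun e => by
    convert hlin b⁻¹ (-a / b) _ _ _ _ _ _ (h₃ _ _ _ e) e using 1 <;> field_simp <;> ring
  have e21 : P 0 1 0 → P 1 0 0 := fun e => by
    convert hlin (-b⁻¹) (a / b) _ _ _ _ _ _ (h₃ _ _ _ e) e using 1 <;> field_simp <;> ring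
  have e23 : P 0 1 0 → P 0 0 1 := fun e => by
    convert hlin b⁻¹ (-a / b) _ _ _ _ _ _ (h₁ _ _ _ e) e using 1 <;> field_simp <;> ring
  have e32 : P 0 0 1 → P 0 1 0 := fun e => by
    convert hlin (-b⁻¹) (a / b) _ _ _ _ _ _ (h₁ _ _ _ e) e using 1 <;> field_simp <;> ring
  have hscale : ∀ c x y z x' y' z', c ≠ 0 → P x' y' z' → x' = c * x → y' = c * y → z' = c * z →
      P x y z := by
    rintro c x y z x' y' z' hc h rfl rfl rfl
    convert hlin c⁻¹ 0 _ _ _ _ _ _ h h using 1 <;> field_simp <;> ring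
  have hany : P 1 0 0 ∨ P 0 1 0 ∨ P 0 0 1 := by
    by_cases hx : x = 0
    · by_cases hy : y = 0
      · have hz : z ≠ 0 := fun hz => hne ⟨hx, hy, hz⟩
        exact Or.inr (Or.inr (hscale _ _ _ _ _ _ _ (mul_ne_zero ha hz)
          (hlin 1 1 _ _ _ _ _ _ (h₃ _ _ _ (h₃ _ _ _ h))
            (hlin (-2 * a) 1 _ _ _ _ _ _ (h₃ _ _ _ h) h))
          (by linear_combination -x * hab) (by linear_combination -y * hab) (by ring)))
      · exact Or.inr (Or.inl (hscale _ _ _ _ _ _ _ (mul_ne_zero ha hy)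
          (hlin 1 1 _ _ _ _ _ _ (h₂ _ _ _ (h₂ _ _ _ h))
            (hlin (-2 * a) 1 _ _ _ _ _ _ (h₂ _ _ _ h) h))
          (by linear_combination -x * hab) (by ring) (by linear_combination -z * hab)))
    · exact Or.inl (hscale _ _ _ _ _ _ _ (mul_ne_zero ha hx)
        (hlin 1 1 _ _ _ _ _ _ (h₁ _ _ _ (h₁ _ _ _ h)) (hlin (-2 * a) 1 _ _ _ _ _ _ (h₁ _ _ _ h) h))
        (by ring) (by linear_combination -y * hab) (by linear_combination -z * hab))
  rcases hany with e | e | e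
  · exact hcomb p q r e (e12 e) (e23 (e12 e))
  · exact hcomb p q r (e21 e) e (e23 e)
  · exact hcomb p q r (e21 (e32 e)) (e32 e) e

/-- A subspace of the skew matrices (in coordinates) stable under three coordinate reflections
is trivial. -/
theorem forall_of_invariant_reflection {a b : ℝ} (hab : a ^ 2 + b ^ 2 = 1) (ha : a ≠ 0)
    (hb : b ≠ 0) (P : ℝ → ℝ → ℝ → Prop)
    (hlin : ∀ c d x y z x' y' z', P x y z → P x' y' z' →
      P (c * x + d * x') (c * y + d * y') (c * z + d * z'))
    (h₁ : ∀ x y z, P x y z → P (-x) (a * y + b * z) (b * y - a * z))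
    (h₂ : ∀ x y z, P x y z → P (a * x - b * z) (-y) (-b * x - a * z))
    (h₃ : ∀ x y z, P x y z → P (a * x + b * y) (b * x - a * y) (-z))
    {x y z : ℝ} (h : P x y z) (hne : ¬(x = 0 ∧ y = 0 ∧ z = 0)) (p q r : ℝ) : P p q r := by
  have ha1 : 1 + a ≠ 0 := fun h => hb (by
    have : a = -1 := by linarith
    rw [this] at hab
    nlinarith)
  have hscale : ∀ c x y z x' y' z', c ≠ 0 → P x' y' z' → x' = c * x → y' = c * y → z' = c * z →
      P x y z := by
    rintro c x y z x' y' z' hc h rfl rfl rfl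
    convert hlin c⁻¹ 0 _ _ _ _ _ _ h h using 1 <;> field_simp <;> ring
  have f₁ : ∀ x y z, P x y z → (1 + a) * y + b * z ≠ 0 → P 0 (1 + a) b := fun x y z h hc =>
    hscale (((1 + a) * y + b * z) / (1 + a)) _ _ _ _ _ _ (div_ne_zero hc ha1)
      (hlin 1 1 _ _ _ _ _ _ (h₁ _ _ _ h) h) (by ring) (by field_simp; ring)
      (by field_simp; grind)
  have f₂ : ∀ x y z, P x y z → (1 + a) * x - b * z ≠ 0 → P (1 + a) 0 (-b) := fun x y z h hc =>
    hscale (((1 + a) * x - b * z) / (1 + a)) _ _ _ _ _ _ (div_ne_zero hc ha1)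
      (hlin 1 1 _ _ _ _ _ _ (h₂ _ _ _ h) h) (by field_simp; ring) (by ring)
      (by field_simp; grind)
  have f₃ : ∀ x y z, P x y z → (1 + a) * x + b * y ≠ 0 → P (1 + a) b 0 := fun x y z h hc =>
    hscale (((1 + a) * x + b * y) / (1 + a)) _ _ _ _ _ _ (div_ne_zero hc ha1)
      (hlin 1 1 _ _ _ _ _ _ (h₃ _ _ _ h) h) (by field_simp; ring) (by field_simp; grind)
      (by ring)
  have hdet : 1 + a - b ≠ 0 := fun hc => ha (by
    have : b = 1 + a := by linarith
    rw [this] at hab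
    have : 2 * (1 + a) * a = 0 := by linarith
    simpa [ha1] using this)
  have hdet' : 1 + a + b ≠ 0 := fun hc => ha (by
    have : b = -(1 + a) := by linarith
    rw [this] at hab
    have : 2 * (1 + a) * a = 0 := by linarith
    simpa [ha1] using this)
  have g12 : P 0 (1 + a) b → P (1 + a) 0 (-b) := fun e =>
    f₂ _ _ _ e (by simpa using hb)
  have g23 : P (1 + a) 0 (-b) → P (1 + a) b 0 := fun e =>
    f₃ _ _ _ e (by simpa using ha1)
  have g31 : P (1 + a) b 0 → P 0 (1 + a) b := fun e =>
    f₁ _ _ _ e (by simpa using ⟨ha1, hb⟩)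
  have hany : P 0 (1 + a) b ∨ P (1 + a) 0 (-b) ∨ P (1 + a) b 0 := by
    by_contra hcon
    push Not at hcon
    have c₁ : (1 + a) * y + b * z = 0 := by
      by_contra hc
      exact hcon.1 (f₁ _ _ _ h hc)
    have c₂ : (1 + a) * x - b * z = 0 := by
      by_contra hc
      exact hcon.2.1 (f₂ _ _ _ h hc)
    have c₃ : (1 + a) * x + b * y = 0 := by
      by_contra hc
      exact hcon.2.2 (f₃ _ _ _ h hc)
    have hyz : y = -z := by
      have : b * (y + z) = 0 := by linarith
      rcases mul_eq_zero.mp this with h | h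
      · exact absurd h hb
      · linarith
    have hz : z = 0 := by
      rw [hyz] at c₁
      have : (1 + a - b) * z = 0 := by linarith
      simpa [hdet] using this
    have hx : x = 0 := by
      rw [hz] at c₂
      simpa [ha1] using c₂
    exact hne ⟨hx, by rw [hyz, hz, neg_zero], hz⟩
  have hall : P 0 (1 + a) b ∧ P (1 + a) 0 (-b) ∧ P (1 + a) b 0 := by
    rcases hany with e | e | e
    · exact ⟨e, g12 e, g23 (g12 e)⟩
    · exact ⟨g31 (g23 e), e, g23 e⟩
    · exact ⟨g31 e, g12 (g31 e), e⟩
  obtain ⟨k₁, k₂, k₃⟩ := hall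
  let u := (q - (1 + a) * r / b - b * p / (1 + a)) / (1 + a - b)
  convert hlin 1 (p / (1 + a) - u) _ _ _ _ _ _ (hlin (u + r / b) u _ _ _ _ _ _ k₁ k₂) k₃ using 1
  · field_simp
    ring
  · have hu : u * (1 + a - b) = q - (1 + a) * r / b - b * p / (1 + a) :=
      div_mul_cancel₀ _ hdet
    linear_combination -hu
  · field_simp
    ring

/-- The skew matrices whose orbit under a group is orthogonal to `K` form a subspace. -/
theorem trace_conj_skewThree_linear (h K : Matrix (Fin 3) (Fin 3) ℝ) (c d x y z x' y' z' : ℝ) :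
    (h * skewThree (c * x + d * x') (c * y + d * y') (c * z + d * z') * hᵀ * K).trace =
      c * (h * skewThree x y z * hᵀ * K).trace + d * (h * skewThree x' y' z' * hᵀ * K).trace := by
  have : skewThree (c * x + d * x') (c * y + d * y') (c * z + d * z')
      = c • skewThree x y z + d • skewThree x' y' z' := by
    ext i j
    fin_cases i <;> fin_cases j <;> simp [skewThree] <;> ring
  rw [this]
  simp [mul_add, add_mul, trace_add, trace_smul]

theorem conj_zero_one_skewThree (g : Matrix (Fin 2) (Fin 2) ℝ) (x y z : ℝ) :
    realGateOn g (0 : Fin 3) 1 * skewThree x y z * (realGateOn g (0 : Fin 3) 1)ᵀ =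
      skewThree ((g 0 0 * g 1 1 - g 0 1 * g 1 0) * x) (g 0 0 * y + g 0 1 * z)
        (g 1 0 * y + g 1 1 * z) := by
  rw [realGateOn_zero_one]
  ext i j
  fin_cases i <;> fin_cases j <;>
    simp [skewThree, mul_apply, Fin.sum_univ_three] <;> ring

theorem conj_zero_two_skewThree (g : Matrix (Fin 2) (Fin 2) ℝ) (x y z : ℝ) :
    realGateOn g (0 : Fin 3) 2 * skewThree x y z * (realGateOn g (0 : Fin 3) 2)ᵀ =
      skewThree (g 0 0 * x - g 0 1 * z) ((g 0 0 * g 1 1 - g 0 1 * g 1 0) * y)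
        (g 1 1 * z - g 1 0 * x) := by
  rw [realGateOn_zero_two]
  ext i j
  fin_cases i <;> fin_cases j <;>
    simp [skewThree, mul_apply, Fin.sum_univ_three] <;> ring

theorem conj_one_two_skewThree (g : Matrix (Fin 2) (Fin 2) ℝ) (x y z : ℝ) :
    realGateOn g (1 : Fin 3) 2 * skewThree x y z * (realGateOn g (1 : Fin 3) 2)ᵀ =
      skewThree (g 0 0 * x + g 0 1 * y) (g 1 0 * x + g 1 1 * y)
        ((g 0 0 * g 1 1 - g 0 1 * g 1 0) * z) := by
  rw [realGateOn_one_two]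
  ext i j
  fin_cases i <;> fin_cases j <;>
    simp [skewThree, mul_apply, Fin.sum_univ_three] <;> ring

theorem orthogonal_two_cases {g : Matrix (Fin 2) (Fin 2) ℝ} (hg : g ∈ orthogonalGroup (Fin 2) ℝ)
    (hb : g 0 1 ≠ 0) : g 0 0 ^ 2 + g 1 0 ^ 2 = 1 ∧
      ((g 0 1 = -g 1 0 ∧ g 1 1 = g 0 0) ∨ (g 0 1 = g 1 0 ∧ g 1 1 = -g 0 0)) := by
  have h := (mem_orthogonalGroup_iff (Fin 2) ℝ).mp hg
  have h' := (mem_orthogonalGroup_iff' (Fin 2) ℝ).mp hg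
  have e00 := congrFun (congrFun h 0) 0
  have e01 := congrFun (congrFun h 0) 1
  have e00' := congrFun (congrFun h' 0) 0
  simp [mul_apply, Fin.sum_univ_two] at e00 e01 e00'
  refine ⟨by linarith, ?_⟩
  have hsq : (g 0 1 - g 1 0) * (g 0 1 + g 1 0) = 0 := by linarith
  rcases mul_eq_zero.mp hsq with h | h
  · right
    have h1 : g 0 1 = g 1 0 := by linarith
    rw [← h1] at e01
    have : g 0 1 * (g 0 0 + g 1 1) = 0 := by linarith
    rcases mul_eq_zero.mp this with h2 | h2
    · exact absurd h2 hb
    · exact ⟨h1, by linarith⟩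
  · left
    have h1 : g 1 0 = -g 0 1 := by linarith
    rw [h1] at e01
    have : g 0 1 * (g 1 1 - g 0 0) = 0 := by linarith
    rcases mul_eq_zero.mp this with h2 | h2
    · exact absurd h2 hb
    · exact ⟨by linarith, by linarith⟩

/-- The space of skew matrices is irreducible under the gates on three modes. -/
theorem eq_zero_of_gate_orbit_orthogonal {g : Matrix (Fin 2) (Fin 2) ℝ}
    (hg : g ∈ orthogonalGroup (Fin 2) ℝ) (hne : ∀ i j, g i j ≠ 0)
    (H : Subgroup (orthogonalGroup (Fin 3) ℝ))
    (hgate : ∀ i j : Fin 3, i < j → ∃ h ∈ H, (h : Matrix (Fin 3) (Fin 3) ℝ) = realGateOn g i j)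
    {x y z : ℝ} (hu : x ^ 2 + y ^ 2 + z ^ 2 = 1) (W : Matrix (Fin 3) (Fin 3) ℝ) (hW : Wᵀ = -W)
    (horth : ∀ h ∈ H, ((h : Matrix (Fin 3) (Fin 3) ℝ) * W * (h : Matrix (Fin 3) (Fin 3) ℝ)ᵀ
      * skewThree x y z).trace = 0) : W = 0 := by
  let P : ℝ → ℝ → ℝ → Prop := fun p q r => ∀ h ∈ H,
    ((h : Matrix (Fin 3) (Fin 3) ℝ) * skewThree p q r * (h : Matrix (Fin 3) (Fin 3) ℝ)ᵀ
      * skewThree x y z).trace = 0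
  have hlin : ∀ c d p q r p' q' r', P p q r → P p' q' r' →
      P (c * p + d * p') (c * q + d * q') (c * r + d * r') := by
    intro c d p q r p' q' r' h₁ h₂ h hh
    rw [trace_conj_skewThree_linear, h₁ h hh, h₂ h hh, mul_zero, mul_zero, add_zero]
  have hconj : ∀ i j : Fin 3, i < j → ∀ p q r p' q' r', P p q r →
      realGateOn g i j * skewThree p q r * (realGateOn g i j)ᵀ = skewThree p' q' r' →
      P p' q' r' := by
    intro i j hij p q r p' q' r' hP he h hh
    obtain ⟨k, hk, hkg⟩ := hgate i j hij
    have := hP (h * k) (H.mul_mem hh hk)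
    rw [← he, ← hkg]
    simpa only [Submonoid.coe_mul, transpose_mul, mul_assoc] using this
  by_contra hW0
  have hWE := exists_eq_skewThree hW
  have hPW : P (W 0 1) (W 0 2) (W 1 2) := by
    intro h hh
    rw [← hWE]
    exact horth h hh
  have hWne : ¬(W 0 1 = 0 ∧ W 0 2 = 0 ∧ W 1 2 = 0) := by
    rintro ⟨h1, h2, h3⟩
    rw [h1, h2, h3] at hWE
    apply hW0
    rw [hWE]
    ext i j
    fin_cases i <;> fin_cases j <;> simp [skewThree]
  have hall : ∀ p q r, P p q r := by
    obtain ⟨hab, ⟨hb, hd⟩ | ⟨hb, hd⟩⟩ := orthogonal_two_cases hg (hne 0 1)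
    · refine forall_of_invariant_rotation hab (hne 1 0) P hlin ?_ ?_ ?_ hPW hWne
      · intro p q r hP
        refine hconj 0 1 (by decide) p q r _ _ _ hP ?_
        rw [conj_zero_one_skewThree, hb, hd]
        congr 1
        · linear_combination p * hab
        · ring
      · intro p q r hP
        refine hconj 0 2 (by decide) p q r _ _ _ hP ?_
        rw [conj_zero_two_skewThree, hb, hd]
        congr 1
        · ring
        · linear_combination q * hab
      · intro p q r hP
        refine hconj 1 2 (by decide) p q r _ _ _ hP ?_
        rw [conj_one_two_skewThree, hb, hd]
        congr 1
        · ring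
        · linear_combination r * hab
    · refine forall_of_invariant_reflection hab (hne 0 0) (hne 1 0) P hlin ?_ ?_ ?_ hPW hWne
      · intro p q r hP
        refine hconj 0 1 (by decide) p q r _ _ _ hP ?_
        rw [conj_zero_one_skewThree, hb, hd]
        congr 1
        · linear_combination -p * hab
        · ring
      · intro p q r hP
        refine hconj 0 2 (by decide) p q r _ _ _ hP ?_
        rw [conj_zero_two_skewThree, hb, hd]
        congr 1
        · linear_combination -q * hab
        · ring
      · intro p q r hP
        refine hconj 1 2 (by decide) p q r _ _ _ hP ?_
        rw [conj_one_two_skewThree, hb, hd]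
        congr 1
        · ring
        · linear_combination -r * hab
  have hK := hall x y z 1 H.one_mem
  have hK2 := trace_skewThree_sq x y z
  simp only [Submonoid.coe_one, one_mul, transpose_one, mul_one] at hK
  rw [hK, hu] at hK2
  norm_num at hK2

theorem det_realGateOn_three (g : Matrix (Fin 2) (Fin 2) ℝ) :
    (realGateOn g (0 : Fin 3) 1).det = g.det ∧ (realGateOn g (0 : Fin 3) 2).det = g.det ∧
      (realGateOn g (1 : Fin 3) 2).det = g.det := by
  rw [realGateOn_zero_one, realGateOn_zero_two, realGateOn_one_two]
  simp [det_fin_three, det_fin_two]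

/-- A closed subgroup of `O(3)` containing the nontrivial gates contains every rotation. -/
theorem rodrigues_mem_of_gates {g : Matrix (Fin 2) (Fin 2) ℝ}
    (hg : g ∈ orthogonalGroup (Fin 2) ℝ) (hne : ∀ i j, g i j ≠ 0)
    (H : Subgroup (orthogonalGroup (Fin 3) ℝ))
    (hH : IsClosed (H : Set (orthogonalGroup (Fin 3) ℝ)))
    (hgate : ∀ i j : Fin 3, i < j → ∃ h ∈ H, (h : Matrix (Fin 3) (Fin 3) ℝ) = realGateOn g i j)
    {p q r : ℝ} (hv : p ^ 2 + q ^ 2 + r ^ 2 = 1) (t : ℝ) :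
    ∃ h ∈ H, (h : Matrix (Fin 3) (Fin 3) ℝ) = rodrigues (skewThree p q r) t := by
  by_contra hcon
  have htor : ∀ h ∈ H, (h : Matrix (Fin 3) (Fin 3) ℝ).det = 1 →
      IsTorsionTrace (h : Matrix (Fin 3) (Fin 3) ℝ).trace := by
    intro h hh hdet
    refine (rotation_irrational_or_isTorsionTrace (orthogonal_mul_transpose h)
      hdet).resolve_left ?_
    rintro ⟨x, y, z, θ, hu, hirr, hθ⟩
    refine hcon (rodrigues_mem_of_irreducible H hH hu hv (fun s => ?_)
      (eq_zero_of_gate_orbit_orthogonal hg hne H hgate hu) t)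
    refine ⟨_, rodriguesOrtho_mem_of_irrational (skewThree x y z) (skewThree_transpose x y z)
      (skewThree_cube_of_unit hu) H hH θ hirr ?_ s, rfl⟩
    convert hh
    exact Subtype.ext hθ.symm
  obtain ⟨A, hA, hAg⟩ := hgate 0 1 (by decide)
  obtain ⟨B, hB, hBg⟩ := hgate 0 2 (by decide)
  obtain ⟨C, hC, hCg⟩ := hgate 1 2 (by decide)
  obtain ⟨d₁, d₂, d₃⟩ := det_realGateOn_three g
  obtain ⟨hab, hcases⟩ := orthogonal_two_cases hg (hne 0 1)
  have hbad : g 0 0 = 0 ∨ g 0 0 ^ 2 = 1 := by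
    rcases hcases with ⟨hb, hd⟩ | ⟨hb, hd⟩
    · have hdet : g.det = 1 := by
        rw [det_fin_two, hb, hd]
        linear_combination hab
      refine eq_zero_or_sq_eq_one_of_rotation_traces _ ?_ ?_
      · convert htor A hA (by rw [hAg, d₁, hdet]) using 1
        rw [hAg, realGateOn_zero_one, hb, hd]
        simp [trace, Fin.sum_univ_three]
        ring
      · convert htor (A * C) (H.mul_mem hA hC)
          (by rw [Submonoid.coe_mul, det_mul, hAg, hCg, d₁, d₃, hdet, one_mul]) using 1
        rw [Submonoid.coe_mul, hAg, hCg, realGateOn_zero_one, realGateOn_one_two, hb, hd]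
        simp [trace, Fin.sum_univ_three]
        ring
    · have hdet : g.det = -1 := by
        rw [det_fin_two, hb, hd]
        linear_combination -hab
      refine eq_zero_or_sq_eq_one_of_reflection_traces _ ?_ ?_
      · convert htor (A * B) (H.mul_mem hA hB)
          (by rw [Submonoid.coe_mul, det_mul, hAg, hBg, d₁, d₂, hdet]; norm_num) using 1
        rw [Submonoid.coe_mul, hAg, hBg, realGateOn_zero_one, realGateOn_zero_two, hb, hd]
        simp [trace, Fin.sum_univ_three]
        ring
      · convert htor (A * C) (H.mul_mem hA hC)
          (by rw [Submonoid.coe_mul, det_mul, hAg, hCg, d₁, d₃, hdet]; norm_num) using 1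
        rw [Submonoid.coe_mul, hAg, hCg, realGateOn_zero_one, realGateOn_one_two, hb, hd]
        simp [trace, Fin.sum_univ_three]
        ring
  rcases hbad with h | h
  · exact hne 0 0 h
  · rw [h] at hab
    exact hne 1 0 (by simpa using hab)

/-- The two-mode rotation by the angle `t`. -/
noncomputable def planeRotation (t : ℝ) : Matrix (Fin 2) (Fin 2) ℝ :=
  !![Real.cos t, Real.sin t; -Real.sin t, Real.cos t]

theorem planeRotation_mem_of_gates {g : Matrix (Fin 2) (Fin 2) ℝ}
    (hg : g ∈ orthogonalGroup (Fin 2) ℝ) (hne : ∀ i j, g i j ≠ 0)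
    (H : Subgroup (orthogonalGroup (Fin 3) ℝ))
    (hH : IsClosed (H : Set (orthogonalGroup (Fin 3) ℝ)))
    (hgate : ∀ i j : Fin 3, i < j → ∃ h ∈ H, (h : Matrix (Fin 3) (Fin 3) ℝ) = realGateOn g i j)
    (i j : Fin 3) (hij : i < j) (t : ℝ) :
    ∃ h ∈ H, (h : Matrix (Fin 3) (Fin 3) ℝ) = realGateOn (planeRotation t) i j := by
  have key : ∃ p q r : ℝ, p ^ 2 + q ^ 2 + r ^ 2 = 1 ∧
      realGateOn (planeRotation t) i j = rodrigues (skewThree p q r) t := by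
    have hcases : (i = 0 ∧ j = 1) ∨ (i = 0 ∧ j = 2) ∨ (i = 1 ∧ j = 2) := by
      revert i j
      decide
    rcases hcases with ⟨rfl, rfl⟩ | ⟨rfl, rfl⟩ | ⟨rfl, rfl⟩
    · refine ⟨1, 0, 0, by norm_num, ?_⟩
      rw [realGateOn_zero_one]
      ext k l
      fin_cases k <;> fin_cases l <;>
        simp [planeRotation, rodrigues, skewThree]
    · refine ⟨0, 1, 0, by norm_num, ?_⟩
      rw [realGateOn_zero_two]
      ext k l
      fin_cases k <;> fin_cases l <;>
        simp [planeRotation, rodrigues, skewThree]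
    · refine ⟨0, 0, 1, by norm_num, ?_⟩
      rw [realGateOn_one_two]
      ext k l
      fin_cases k <;> fin_cases l <;>
        simp [planeRotation, rodrigues, skewThree]
  obtain ⟨p, q, r, hv, he⟩ := key
  rw [he]
  exact rodrigues_mem_of_gates hg hne H hH hgate hv t

section Embedding

variable {n k : Type*} [Fintype n] [DecidableEq n] [Fintype k] [DecidableEq k]

/-- The matrix of the linear map sending basis vectors to basis vectors along `e`. -/
def inclusionMatrix (e : n → k) : Matrix k n ℝ :=
  of fun i a => if i = e a then 1 else 0

omit [Fintype k] in
theorem inclusionMatrix_mul_single (e : n → k) (a b : n) (c : ℝ) :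
    inclusionMatrix e * single a b c * (inclusionMatrix e)ᵀ = single (e a) (e b) c := by
  have hcol : ∀ p : n, inclusionMatrix e *ᵥ Pi.single p 1 = Pi.single (e p) 1 := fun p => by
    ext i
    simp [inclusionMatrix, Pi.single_apply]
  have ha : single a b c = c • vecMulVec (Pi.single a 1) (Pi.single b 1) := by
    rw [← single_eq_single_vecMulVec_single, smul_single, smul_eq_mul, mul_one]
  rw [ha, Matrix.mul_smul, Matrix.smul_mul, mul_vecMulVec, vecMulVec_mul, vecMul_transpose, hcol,
    hcol, ← single_eq_single_vecMulVec_single, smul_single, smul_eq_mul, mul_one]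

omit [Fintype n] in
theorem inclusionMatrix_transpose_mul {e : n → k} (he : Function.Injective e) :
    (inclusionMatrix e)ᵀ * inclusionMatrix e = 1 := by
  ext a b
  simp [inclusionMatrix, mul_apply, one_apply, he.eq_iff, eq_comm]

/-- A matrix acting on the coordinates in the range of `e`, extended by the identity. -/
def extendMatrix (e : n → k) (M : Matrix n n ℝ) : Matrix k k ℝ :=
  inclusionMatrix e * M * (inclusionMatrix e)ᵀ + (1 - inclusionMatrix e * (inclusionMatrix e)ᵀ)

omit [Fintype k] in
theorem extendMatrix_one (e : n → k) : extendMatrix e 1 = 1 := by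
  simp [extendMatrix]

theorem extendMatrix_mul {e : n → k} (he : Function.Injective e) (M N : Matrix n n ℝ) :
    extendMatrix e (M * N) = extendMatrix e M * extendMatrix e N := by
  have h := inclusionMatrix_transpose_mul he
  have h' : ∀ X : Matrix n k ℝ, (inclusionMatrix e)ᵀ * (inclusionMatrix e * X) = X := by
    intro X
    rw [← Matrix.mul_assoc, h, Matrix.one_mul]
  simp only [extendMatrix, Matrix.mul_add, Matrix.add_mul, Matrix.mul_sub, Matrix.sub_mul,
    Matrix.mul_assoc, Matrix.one_mul, Matrix.mul_one, h']
  abel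

omit [DecidableEq n] [Fintype k] in
theorem extendMatrix_transpose (e : n → k) (M : Matrix n n ℝ) :
    (extendMatrix e M)ᵀ = extendMatrix e Mᵀ := by
  simp [extendMatrix, transpose_mul, Matrix.mul_assoc]

/-- The inclusion of orthogonal groups along an injection of coordinates. -/
def extendOrtho (e : n → k) (he : Function.Injective e) :
    orthogonalGroup n ℝ →* orthogonalGroup k ℝ where
  toFun M := ⟨extendMatrix e M, by
    rw [mem_orthogonalGroup_iff, extendMatrix_transpose, ← extendMatrix_mul he,
      orthogonal_mul_transpose, extendMatrix_one]⟩
  map_one' := Subtype.ext (extendMatrix_one e)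
  map_mul' M N := Subtype.ext (extendMatrix_mul he M N)

theorem continuous_extendOrtho (e : n → k) (he : Function.Injective e) :
    Continuous (extendOrtho e he) := by
  have : Continuous fun h : orthogonalGroup n ℝ => (h : Matrix n n ℝ) := continuous_subtype_val
  refine Continuous.subtype_mk ?_ _
  unfold extendMatrix
  fun_prop

end Embedding

theorem realGateOn_eq_single {m : ℕ} (g : Matrix (Fin 2) (Fin 2) ℝ) {i j : Fin m} (hij : i ≠ j) :
    realGateOn g i j = 1 + (single i i (g 0 0 - 1) + single i j (g 0 1) + single j i (g 1 0)
      + single j j (g 1 1 - 1)) := by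
  ext k l
  simp only [realGateOn, of_apply, Matrix.add_apply, single_apply, one_apply]
  grind

theorem extendMatrix_realGateOn {m k : ℕ} (g : Matrix (Fin 2) (Fin 2) ℝ) {e : Fin m → Fin k}
    (he : Function.Injective e) {i j : Fin m} (hij : i ≠ j) :
    extendMatrix e (realGateOn g i j) = realGateOn g (e i) (e j) := by
  rw [realGateOn_eq_single g hij, realGateOn_eq_single g (he.ne hij), extendMatrix]
  simp only [Matrix.mul_add, Matrix.add_mul, inclusionMatrix_mul_single, Matrix.mul_one]
  abel

theorem exists_strictMono_of_lt {m : ℕ} (hm : 3 ≤ m) {i j : Fin m} (hij : i < j) :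
    ∃ (e : Fin 3 → Fin m) (a b : Fin 3), StrictMono e ∧ a < b ∧ e a = i ∧ e b = j := by
  obtain ⟨k, hki, hkj⟩ : ∃ k : Fin m, k ≠ i ∧ k ≠ j := by
    by_contra! h
    have hsub : (Finset.univ : Finset (Fin m)) ⊆ {i, j} := fun k _ => by
      by_cases hk : k = i
      · simp [hk]
      · simp [h k hk]
    have := (Finset.card_le_card hsub).trans Finset.card_le_two
    simp at this
    omega
  have hmono : ∀ x y z : Fin m, x < y → y < z → StrictMono ![x, y, z] := by
    intro x y z hxy hyz
    rw [Fin.strictMono_iff_lt_succ]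
    intro s
    fin_cases s
    · exact hxy
    · exact hyz
  rcases lt_or_gt_of_ne hki with h | h
  · exact ⟨![k, i, j], 1, 2, hmono _ _ _ h hij, by decide, rfl, rfl⟩
  · rcases lt_or_gt_of_ne hkj with h' | h'
    · exact ⟨![i, k, j], 0, 2, hmono _ _ _ h h', by decide, rfl, rfl⟩
    · exact ⟨![i, j, k], 0, 1, hmono _ _ _ hij h', by decide, rfl, rfl⟩

theorem realGateOn_mem_orthogonalGroup {g : Matrix (Fin 2) (Fin 2) ℝ}
    (hg : g ∈ orthogonalGroup (Fin 2) ℝ) {i j : Fin 3} (hij : i < j) :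
    realGateOn g i j ∈ orthogonalGroup (Fin 3) ℝ := by
  have h := (mem_orthogonalGroup_iff (Fin 2) ℝ).mp hg
  have e00 := congrFun (congrFun h 0) 0
  have e01 := congrFun (congrFun h 0) 1
  have e10 := congrFun (congrFun h 1) 0
  have e11 := congrFun (congrFun h 1) 1
  simp [mul_apply, Fin.sum_univ_two] at e00 e01 e10 e11
  have hcases : (i = 0 ∧ j = 1) ∨ (i = 0 ∧ j = 2) ∨ (i = 1 ∧ j = 2) := by
    revert i j
    decide
  rw [mem_orthogonalGroup_iff]
  rcases hcases with ⟨rfl, rfl⟩ | ⟨rfl, rfl⟩ | ⟨rfl, rfl⟩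
  · rw [realGateOn_zero_one]
    ext k l
    fin_cases k <;> fin_cases l <;> simp [mul_apply, Fin.sum_univ_three, e00, e01, e10, e11]
  · rw [realGateOn_zero_two]
    ext k l
    fin_cases k <;> fin_cases l <;> simp [mul_apply, Fin.sum_univ_three, e00, e01, e10, e11]
  · rw [realGateOn_one_two]
    ext k l
    fin_cases k <;> fin_cases l <;> simp [mul_apply, Fin.sum_univ_three, e00, e01, e10, e11]

/-- A closed subgroup containing the nontrivial gates contains all coordinate plane rotations. -/
theorem planeRotation_mem_of_gates_of_three_le {m : ℕ} (hm : 3 ≤ m)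
    {g : Matrix (Fin 2) (Fin 2) ℝ}
    (hg : g ∈ orthogonalGroup (Fin 2) ℝ) (hne : ∀ i j, g i j ≠ 0)
    (H : Subgroup (orthogonalGroup (Fin m) ℝ))
    (hH : IsClosed (H : Set (orthogonalGroup (Fin m) ℝ)))
    (hgate : ∀ h : orthogonalGroup (Fin m) ℝ, ∀ i j : Fin m, i < j →
      (h : Matrix (Fin m) (Fin m) ℝ) = realGateOn g i j → h ∈ H)
    (i j : Fin m) (hij : i < j) (t : ℝ) :
    ∃ h ∈ H, (h : Matrix (Fin m) (Fin m) ℝ) = realGateOn (planeRotation t) i j := by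
  obtain ⟨e, a, b, he, hab, rfl, rfl⟩ := exists_strictMono_of_lt hm hij
  obtain ⟨h, hh, hval⟩ := planeRotation_mem_of_gates hg hne (H.comap (extendOrtho e he.injective))
    (hH.preimage (continuous_extendOrtho e he.injective)) (by
      intro c d hcd
      refine ⟨⟨_, realGateOn_mem_orthogonalGroup hg hcd⟩, hgate _ (e c) (e d) (he hcd) ?_, rfl⟩
      exact extendMatrix_realGateOn g he.injective hcd.ne) a b hab t
  refine ⟨_, hh, ?_⟩
  change extendMatrix e h = _
  rw [hval, extendMatrix_realGateOn _ he.injective hab.ne]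

section PlaneRotations

variable {m : ℕ}

/-- The infinitesimal rotation of the plane spanned by two coordinate axes. -/
def planeGenerator (i j : Fin m) : Matrix (Fin m) (Fin m) ℝ :=
  single i j 1 - single j i 1

theorem planeGenerator_sq {i j : Fin m} (hij : i ≠ j) :
    planeGenerator i j * planeGenerator i j = -(single i i 1 + single j j 1) := by
  simp [planeGenerator, mul_sub, sub_mul, single_mul_single_same, single_mul_single_of_ne, hij,
    hij.symm]
  abel

theorem planeGenerator_cube {i j : Fin m} (hij : i ≠ j) :
    planeGenerator i j * planeGenerator i j * planeGenerator i j = -planeGenerator i j := by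
  rw [planeGenerator_sq hij]
  simp [planeGenerator, mul_sub, add_mul, single_mul_single_same, single_mul_single_of_ne, hij,
    hij.symm]
  abel

theorem realGateOn_planeRotation {i j : Fin m} (hij : i ≠ j) (t : ℝ) :
    realGateOn (planeRotation t) i j = rodrigues (planeGenerator i j) t := by
  rw [realGateOn_eq_single _ hij, rodrigues, planeGenerator_sq hij]
  ext k l
  simp only [planeRotation, planeGenerator, single_apply, Matrix.add_apply, Matrix.sub_apply,
    Matrix.neg_apply, Matrix.smul_apply, smul_eq_mul, of_apply, cons_val', cons_val_zero,
    cons_val_one, cons_val_fin_one]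
  grind

/-- A combination of `sin` and `1 - cos` which is never positive has no `sin` term. -/
theorem coeff_of_forall_sin_add_cos_nonpos {α β : ℝ}
    (h : ∀ t : ℝ, Real.sin t * α + (1 - Real.cos t) * β ≤ 0) : α = 0 ∧ β ≤ 0 := by
  constructor
  · let f : ℝ → ℝ := fun t => Real.sin t * α + (1 - Real.cos t) * β
    have hloc : IsLocalMax f 0 := Filter.Eventually.of_forall fun t => by
      simpa [f] using h t
    have hd := ((Real.hasDerivAt_sin 0).mul_const α).add
      (((Real.hasDerivAt_cos 0).const_sub 1).mul_const β)
    simpa using hloc.hasDerivAt_eq_zero hd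
  · have := h Real.pi
    rw [Real.sin_pi, Real.cos_pi] at this
    linarith

/-- A special orthogonal matrix which cannot be improved by plane rotations with respect to a
generic weighted trace is the identity. -/
theorem eq_one_of_weighted_trace_max {B : Matrix (Fin m) (Fin m) ℝ} (hB : B * Bᵀ = 1)
    (hdet : B.det = 1) {c : Fin m → ℝ} (hpos : ∀ i, 0 < c i) (hanti : StrictAnti c)
    (hmax : ∀ i j, i < j → ∀ t,
      (rodrigues (planeGenerator i j) t * (B * diagonal c)).trace ≤ (B * diagonal c).trace) :
    B = 1 := by
  have hB' : Bᵀ * B = 1 := mul_eq_one_comm.mp hB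
  have hcrit : ∀ i j, i < j → B j i * c i = B i j * c j ∧ 0 ≤ B i i * c i + B j j * c j := by
    intro i j hij
    have h := coeff_of_forall_sin_add_cos_nonpos
      (α := B j i * c i - B i j * c j) (β := -(B i i * c i + B j j * c j)) (fun t => by
        have := hmax i j hij t
        rw [rodrigues, planeGenerator_sq hij.ne] at this
        simp only [planeGenerator, add_mul, one_mul, smul_mul_assoc, sub_mul, neg_mul, trace_add,
          trace_sub, trace_neg, trace_smul, smul_eq_mul, trace_single_mul, mul_diagonal] at this
        linarith)
    exact ⟨by linarith [h.1], by linarith [h.2]⟩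
  have hsymm : (B * diagonal c)ᵀ = B * diagonal c := by
    ext i j
    rw [transpose_apply, mul_diagonal, mul_diagonal]
    rcases lt_trichotomy i j with h | h | h
    · exact (hcrit i j h).1
    · rw [h]
    · exact ((hcrit j i h).1).symm
  have hcomm : B * (diagonal c * diagonal c) = diagonal c * diagonal c * B := by
    have h1 : diagonal c * Bᵀ = B * diagonal c := by
      rw [← hsymm, transpose_mul, diagonal_transpose]
    have h2 : Bᵀ * diagonal c = diagonal c * B := by
      calc Bᵀ * diagonal c = Bᵀ * (diagonal c * Bᵀ) * B := by
            rw [mul_assoc, mul_assoc, hB', mul_one]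
        _ = diagonal c * B := by rw [h1, ← mul_assoc, hB', one_mul]
    rw [← mul_assoc, ← h1, mul_assoc, h2, ← mul_assoc]
  have hoff : ∀ i j, i ≠ j → B i j = 0 := by
    intro i j hij
    have h := congrFun (congrFun hcomm i) j
    rw [diagonal_mul_diagonal, mul_diagonal, diagonal_mul] at h
    have hc : c i * c i - c j * c j ≠ 0 := by
      have : (c i - c j) * (c i + c j) ≠ 0 :=
        mul_ne_zero (sub_ne_zero.mpr (hanti.injective.ne hij))
          (add_pos (hpos i) (hpos j)).ne'
      intro h0
      exact this (by linarith)
    have : (c i * c i - c j * c j) * B i j = 0 := by linarith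
    exact (mul_eq_zero.mp this).resolve_left hc
  have hdiag : B = diagonal fun i => B i i := by
    ext i j
    by_cases hij : i = j
    · rw [hij, diagonal_apply_eq]
    · rw [diagonal_apply_ne _ hij, hoff i j hij]
  have hsq : ∀ i, B i i = 1 ∨ B i i = -1 := by
    intro i
    have h := congrFun (congrFun hB i) i
    rw [hdiag, diagonal_transpose, diagonal_mul_diagonal, diagonal_apply_eq, one_apply_eq] at h
    exact mul_self_eq_one_iff.mp h
  have hlt : ∀ i j, i < j → B i i = 1 := by
    intro i j hij
    refine (hsq i).resolve_right fun h => ?_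
    have h1 := (hcrit i j hij).2
    have h2 := hanti hij
    have h3 := hpos j
    rw [h] at h1
    rcases hsq j with h4 | h4 <;> rw [h4] at h1 <;> linarith
  have hone : ∀ i, B i i = 1 := by
    intro i
    by_cases hi : ∃ j, i < j
    · obtain ⟨j, hj⟩ := hi
      exact hlt i j hj
    · push Not at hi
      rw [hdiag, det_diagonal, Finset.prod_eq_single i
        (fun j _ hj => hlt j i (lt_of_le_of_ne (hi j) hj)) (by simp)] at hdet
      exact hdet
  rw [hdiag]
  simp [hone]

/-- A closed subgroup of `O(m)` containing all coordinate plane rotations contains `SO(m)`. -/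
theorem mem_of_planeRotation_mem (H : Subgroup (orthogonalGroup (Fin m) ℝ))
    (hH : IsClosed (H : Set (orthogonalGroup (Fin m) ℝ)))
    (hrot : ∀ i j : Fin m, i < j → ∀ t, ∃ h ∈ H,
      (h : Matrix (Fin m) (Fin m) ℝ) = realGateOn (planeRotation t) i j)
    (A : orthogonalGroup (Fin m) ℝ) (hA : (A : Matrix (Fin m) (Fin m) ℝ).det = 1) : A ∈ H := by
  have := compactSpace_orthogonalGroup (Fin m)
  have hval : Continuous fun h : orthogonalGroup (Fin m) ℝ => (h : Matrix (Fin m) (Fin m) ℝ) :=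
    continuous_subtype_val
  let c : Fin m → ℝ := fun i => m - i
  let S : Set (orthogonalGroup (Fin m) ℝ) :=
    {h | h ∈ H ∧ (h : Matrix (Fin m) (Fin m) ℝ).det = 1}
  have hS : IsClosed S := hH.inter (isClosed_eq hval.matrix_det continuous_const)
  have hF : Continuous fun h : orthogonalGroup (Fin m) ℝ =>
      ((h : Matrix (Fin m) (Fin m) ℝ) * A * diagonal c).trace := by
    fun_prop
  obtain ⟨h₀, ⟨hh₀, hd₀⟩, hmax⟩ := hS.isCompact.exists_isMaxOn ⟨1, H.one_mem, by simp⟩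
    hF.continuousOn
  have hB : (h₀ : Matrix (Fin m) (Fin m) ℝ) * A = 1 := by
    refine eq_one_of_weighted_trace_max (c := c) (orthogonal_mul_transpose (h₀ * A))
      (by rw [det_mul, hd₀, hA, one_mul]) ?_ ?_ ?_
    · intro i
      have : ((i : ℕ) : ℝ) < m := by exact_mod_cast i.2
      simp only [c]
      linarith
    · intro i j hij
      have : ((i : ℕ) : ℝ) < ((j : ℕ) : ℝ) := by exact_mod_cast hij
      simp only [c]
      linarith
    · intro i j hij t
      obtain ⟨k, hk, hkt⟩ := hrot i j hij (t / 2)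
      rw [realGateOn_planeRotation hij.ne] at hkt
      have hkk : ((k * k : orthogonalGroup (Fin m) ℝ) : Matrix (Fin m) (Fin m) ℝ)
          = rodrigues (planeGenerator i j) t := by
        rw [Submonoid.coe_mul, hkt, ← rodrigues_add (planeGenerator_cube hij.ne), add_halves]
      have hdk : ((k : Matrix (Fin m) (Fin m) ℝ) * k).det = 1 := by
        have := congrArg det (orthogonal_mul_transpose k)
        rwa [det_mul, det_transpose, det_one, ← det_mul] at this
      have hle := hmax (show k * k * h₀ ∈ S from ⟨H.mul_mem (H.mul_mem hk hk) hh₀, by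
        rw [Submonoid.coe_mul, Submonoid.coe_mul, det_mul, hdk, hd₀, one_mul]⟩)
      rw [← hkk]
      simpa only [Set.mem_ofPred_eq, Submonoid.coe_mul, mul_assoc] using hle
  have hinv : A = h₀⁻¹ := eq_inv_of_mul_eq_one_right (Subtype.ext hB)
  rw [hinv]
  exact H.inv_mem hh₀

end PlaneRotations

end OrthogonalGates

/-- For any nontrivial two-mode real optical gate `g` (a real 2×2
orthogonal matrix with all entries nonzero) and any `m ≥ 3`, the closure of the subgroup of
`O(m)` generated by all the `g_{ij}` (`i < j`) contains every m×m special orthogonal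
matrix. -/
theorem real_gate_closure_contains_SOm
    (m : ℕ) (hm : 3 ≤ m)
    (g : Matrix (Fin 2) (Fin 2) ℝ) (hg : g ∈ Matrix.orthogonalGroup (Fin 2) ℝ)
    (hnontriv : ∀ i j : Fin 2, g i j ≠ 0)
    (A : Matrix.orthogonalGroup (Fin m) ℝ) (hA : (A : Matrix (Fin m) (Fin m) ℝ).det = 1) :
    A ∈ closure ((Subgroup.closure
        {B : Matrix.orthogonalGroup (Fin m) ℝ | ∃ i j : Fin m, i < j ∧
          (B : Matrix (Fin m) (Fin m) ℝ) = realGateOn g i j} :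
        Subgroup (Matrix.orthogonalGroup (Fin m) ℝ)) :
      Set (Matrix.orthogonalGroup (Fin m) ℝ)) := by
  let G : Subgroup (Matrix.orthogonalGroup (Fin m) ℝ) := Subgroup.closure
    {B : Matrix.orthogonalGroup (Fin m) ℝ | ∃ i j : Fin m, i < j ∧
      (B : Matrix (Fin m) (Fin m) ℝ) = realGateOn g i j}
  have hG : IsClosed (G.topologicalClosure : Set (Matrix.orthogonalGroup (Fin m) ℝ)) :=
    G.isClosed_topologicalClosure
  exact mem_of_planeRotation_mem G.topologicalClosure hG
    (planeRotation_mem_of_gates_of_three_le hm hg hnontriv _ hG fun h i j hij hh =>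
      G.le_topologicalClosure (Subgroup.subset_closure ⟨i, j, hij, hh⟩)) A hA
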